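/- Let C be an entry-faithful (X,2)-neighbour transitive code in H(m,q) with |C| ≥ 2, minimum distance δ ≥ 5, and the zero vertex 0 ∈ C, and suppose the socle of X equals the socle of the stabiliser X_0 of the zero codeword. Then δ = m, q = 2, and C is equivalent to the binary repetition code Rep(m,2). -/

import Mathlib

open Equiv

namespace NT

/-- Vertices of the Hamming graph `H(m,q)`. -/
abbrev V (m q : ℕ) := Fin m → Fin q

/-- The automorphism of `H(m,q)` determined by alphabet permutations `g` and
an entry permutation `σ`:  `α ↦ (i ↦ gᵢ (α (σ⁻¹ i)))`. -/
def hAut (m q : ℕ) (g : Fin m → Perm (Fin q)) (σ : Perm (Fin m)) :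
    Perm (V m q) where
  toFun α := fun i => g i (α (σ⁻¹ i))
  invFun α := fun i => (g (σ i))⁻¹ (α (σ i))
  left_inv α := by funext i; simp
  right_inv α := by funext i; simp

/-- The automorphism group of the Hamming graph, as a subgroup of the group of
all permutations of the vertex set:  `S_q^m ⋊ S_m`. -/
def HammingAut (m q : ℕ) : Subgroup (Perm (V m q)) where
  carrier := {x | ∃ g σ, x = hAut m q g σ}
  one_mem' := ⟨fun _ => 1, 1, by ext α i; simp [hAut]⟩
  mul_mem' := by
    rintro x y ⟨g, σ, rfl⟩ ⟨h, τ, rfl⟩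
    exact ⟨fun i => g i * h (σ⁻¹ i), σ * τ, by ext α i; simp [hAut, Perm.mul_apply]⟩
  inv_mem' := by
    rintro x ⟨g, σ, rfl⟩
    refine ⟨fun i => (g (σ i))⁻¹, σ⁻¹, ?_⟩
    ext α i
    simp [hAut, Perm.inv_def]

/-- The minimum distance of a code `C ⊆ H(m,q)`. -/
noncomputable def minDist (m q : ℕ) (C : Set (V m q)) : ℕ :=
  sInf {d | ∃ α ∈ C, ∃ β ∈ C, α ≠ β ∧ hammingDist α β = d}

/-- The distance `d(α, C)` from a vertex to a code. -/
noncomputable def distTo (m q : ℕ) (C : Set (V m q)) (α : V m q) : ℕ :=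
  sInf {d | ∃ β ∈ C, hammingDist α β = d}

/-- `C_r`, the set of vertices at distance exactly `r` from the code `C`. -/
def cell (m q : ℕ) (C : Set (V m q)) (r : ℕ) : Set (V m q) :=
  {α | distTo m q C α = r}

/-- The covering radius of a code. -/
noncomputable def covRad (m q : ℕ) (C : Set (V m q)) : ℕ :=
  sSup (Set.range (distTo m q C))

/-- `S` is an orbit of the subgroup `X ≤ Sym(V)`. -/
def IsOrbit (m q : ℕ) (X : Subgroup (Perm (V m q))) (S : Set (V m q)) : Prop :=
  S.Nonempty ∧ (∀ x ∈ X, ∀ ν ∈ S, x ν ∈ S) ∧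
    ∀ ν ∈ S, ∀ μ ∈ S, ∃ x ∈ X, x ν = μ

/-- `C` is `(X,s)`-neighbour transitive:  `X` is a group of automorphisms of the
Hamming graph and each of `C, C_1, …, C_s` is an `X`-orbit. -/
def IsNT (m q : ℕ) (X : Subgroup (Perm (V m q))) (C : Set (V m q)) (s : ℕ) : Prop :=
  X ≤ HammingAut m q ∧ IsOrbit m q X C ∧
    ∀ i, 1 ≤ i → i ≤ s → IsOrbit m q X (cell m q C i)

/-- `X` acts faithfully on the set of entries, i.e. `X ∩ S_q^m = 1`. -/
def EntryFaithful (m q : ℕ) (X : Subgroup (Perm (V m q))) : Prop :=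
  ∀ x ∈ X, (∃ g, x = hAut m q g 1) → x = 1

/-- The image of `X` in `S_m` under the entry action `μ`. -/
def entryImage (m q : ℕ) (X : Subgroup (Perm (V m q))) : Set (Perm (Fin m)) :=
  {σ | ∃ x ∈ X, ∃ g, x = hAut m q g σ}

/-- Two codes are equivalent if one is the image of the other under an
automorphism of the Hamming graph. -/
def CodeEquiv (m q : ℕ) (C C' : Set (V m q)) : Prop :=
  ∃ x ∈ HammingAut m q, x '' C = C'

/-- The repetition code: all constant tuples. -/
def RepCode (m q : ℕ) : Set (V m q) := {α | ∃ a, α = fun _ => a}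

/-- The zero vertex. -/
def zeroV (m q : ℕ) [NeZero q] : V m q := fun _ => 0

/-- The weight of a vertex: the number of nonzero entries. -/
noncomputable def wt (m q : ℕ) [NeZero q] (α : V m q) : ℕ :=
  hammingNorm α

/-- `α` covers `ν` if `α` agrees with `ν` on every nonzero entry of `ν`. -/
def Covers (m q : ℕ) [NeZero q] (α ν : V m q) : Prop :=
  ∀ i, ν i ≠ 0 → ν i = α i

/-- A `q`-ary `s-(m,k,λ)` design: a set of weight-`k` vertices such that every
weight-`s` vertex is covered by exactly `λ` of them. -/
noncomputable def IsDesign (m q : ℕ) [NeZero q] (s k lam : ℕ) (D : Set (V m q)) : Prop :=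
  (∀ α ∈ D, wt m q α = k) ∧
    ∀ ν : V m q, wt m q ν = s → {α ∈ D | Covers m q α ν}.ncard = lam

/-- `C` is `s`-regular: for each `i ≤ s` and `k ≤ m`, the number
`|Γ_k(ν) ∩ C|` is the same for all `ν ∈ C_i`. -/
def SRegular (m q : ℕ) (C : Set (V m q)) (s : ℕ) : Prop :=
  ∀ i ≤ s, ∀ k ≤ m, ∀ ν ∈ cell m q C i, ∀ μ ∈ cell m q C i,
    {β ∈ C | hammingDist ν β = k}.ncard = {β ∈ C | hammingDist μ β = k}.ncard

/-- The automorphism group of a code: the setwise stabiliser of `C` in the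
automorphism group of the Hamming graph. -/
def AutCode (m q : ℕ) (C : Set (V m q)) : Subgroup (Perm (V m q)) where
  carrier := {x | x ∈ HammingAut m q ∧ x '' C = C}
  one_mem' := ⟨(HammingAut m q).one_mem, by simp⟩
  mul_mem' := by
    rintro x y ⟨hx, hx'⟩ ⟨hy, hy'⟩
    exact ⟨mul_mem hx hy, by rw [Perm.coe_mul, Set.image_comp, hy', hx']⟩
  inv_mem' := by
    rintro x ⟨hx, hx'⟩
    refine ⟨inv_mem hx, ?_⟩
    conv_lhs => rw [← hx']
    rw [← Set.image_comp]
    simp [Perm.inv_def]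

/-- `N` is a minimal normal subgroup of the (sub)group `H`. -/
def IsMinNormalIn {G : Type*} [Group G] (H N : Subgroup G) : Prop :=
  N ≤ H ∧ N ≠ ⊥ ∧ (∀ h ∈ H, ∀ n ∈ N, h * n * h⁻¹ ∈ N) ∧
    ∀ K : Subgroup G, K ≤ H → K ≠ ⊥ →
      (∀ h ∈ H, ∀ k ∈ K, h * k * h⁻¹ ∈ K) → K ≤ N → K = N

/-- The socle of a subgroup `H`: the subgroup generated by all minimal
normal subgroups of `H`. -/
def socleIn {G : Type*} [Group G] (H : Subgroup G) : Subgroup G :=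
  ⨆ N ∈ {N : Subgroup G | IsMinNormalIn H N}, N

/-- A row of the punctured Hadamard 12 code: the binary vector whose entry at
`a ∈ F₁₁` is `1` exactly when `a - b` is a square in `F₁₁` (including `0`),
corresponding to the translate by `b` of the first row of the normalised Paley
Hadamard matrix of order 12 (with the `*` coordinate deleted, and with the
Hadamard entry `-1` encoded as `1`, `1` as `0`). -/
def hadRow (b : ZMod 11) : V 11 2 :=
  fun i => if ∃ c : ZMod 11, c ^ 2 = ((i : ℕ) : ZMod 11) - b then 1 else 0

/-- The punctured Hadamard code of length 12 in `H(11,2)`: the zero vector and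
all-ones vector (from the all-`(-1)` row of `-H₁₂` and of `H₁₂`), the eleven
weight-6 rows `hadRow b`, and their complements (the rows of `-H₁₂`). -/
def PHad : Set (V 11 2) :=
  {(fun _ => 0), (fun _ => 1)} ∪ Set.range hadRow ∪
    Set.range (fun b => (fun i => 1 - hadRow b i : V 11 2))

/-- The even weight subcode of the punctured Hadamard code of length 12: the
zero vector together with the eleven weight-6 codewords. -/
def ESub : Set (V 11 2) :=
  insert (fun _ => 0) (Set.range hadRow)

end NT

namespace NT

variable {m q : ℕ}

theorem hammingDist_hAut (g : Fin m → Perm (Fin q)) (σ : Perm (Fin m)) (α β : V m q) :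
    hammingDist (hAut m q g σ α) (hAut m q g σ β) = hammingDist α β := by
  unfold hammingDist
  refine Finset.card_bij (fun i _ => σ⁻¹ i) ?_ ?_ ?_
  · intro i hi
    simpa [hAut] using hi
  · intro i _ j _ h
    simpa using h
  · intro i hi
    refine ⟨σ i, ?_, by simp⟩
    simpa [hAut] using hi

theorem hammingDist_apply_of_mem {x : Perm (V m q)} (hx : x ∈ HammingAut m q) (α β : V m q) :
    hammingDist (x α) (x β) = hammingDist α β := by
  obtain ⟨g, σ, rfl⟩ := hx
  exact hammingDist_hAut g σ α β

theorem minDist_le {C : Set (V m q)} {α β : V m q} (hα : α ∈ C) (hβ : β ∈ C) (h : α ≠ β) :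
    minDist m q C ≤ hammingDist α β :=
  Nat.sInf_le ⟨α, hα, β, hβ, h, rfl⟩

/-- Within half the minimum distance of a codeword, the distance to the code is the
distance to that codeword. -/
theorem distTo_eq_of_two_mul_le {C : Set (V m q)} {α γ : V m q} (hγ : γ ∈ C)
    (h : 2 * hammingDist α γ ≤ minDist m q C) : distTo m q C α = hammingDist α γ := by
  refine le_antisymm (Nat.sInf_le ⟨γ, hγ, rfl⟩) (le_csInf ⟨_, γ, hγ, rfl⟩ ?_)
  rintro d ⟨β, hβ, rfl⟩
  by_cases hne : γ = β
  · rw [hne]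
  · have h1 := minDist_le hγ hβ hne
    have h2 := hammingDist_triangle γ α β
    rw [hammingDist_comm γ α] at h2
    omega

/-- Every nontrivial finite subgroup has a minimal normal subgroup. -/
theorem exists_isMinNormalIn {G : Type*} [Group G] [Finite G] {H : Subgroup G} (hH : H ≠ ⊥) :
    ∃ N, IsMinNormalIn H N := by
  obtain ⟨N, ⟨hN, hb, hn⟩, hmin⟩ := Set.Finite.exists_minimal
    (s := {K : Subgroup G | K ≤ H ∧ K ≠ ⊥ ∧ ∀ h ∈ H, ∀ k ∈ K, h * k * h⁻¹ ∈ K})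
    (Set.toFinite _)
    ⟨H, le_rfl, hH, fun h hh k hk => mul_mem (mul_mem hh hk) (inv_mem hh)⟩
  exact ⟨N, hN, hb, hn, fun K hK hKb hKn hle => le_antisymm hle (hmin ⟨hK, hKb, hKn⟩ hle)⟩

theorem IsMinNormalIn.le_socleIn {G : Type*} [Group G] {H N : Subgroup G}
    (h : IsMinNormalIn H N) : N ≤ socleIn H :=
  le_iSup₂ (f := fun (K : Subgroup G) (_ : K ∈ {K | IsMinNormalIn H K}) => K) N h

theorem socleIn_le {G : Type*} [Group G] (H : Subgroup G) : socleIn H ≤ H :=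
  iSup₂_le fun _ hN => hN.1

/-- A subgroup normalised by `X` and fixing one point of an `X`-orbit fixes every point of it. -/
theorem IsOrbit.apply_eq_of_normalised {X K : Subgroup (Perm (V m q))} {C : Set (V m q)}
    (hC : IsOrbit m q X C) (hK : ∀ x ∈ X, ∀ k ∈ K, x * k * x⁻¹ ∈ K) {γ : V m q} (hγ : γ ∈ C)
    (hfix : ∀ k ∈ K, k γ = γ) {k : Perm (V m q)} (hk : k ∈ K) {β : V m q} (hβ : β ∈ C) :
    k β = β := by
  obtain ⟨y, hy, rfl⟩ := hC.2.2 γ hγ β hβ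
  have h := hfix _ (hK y⁻¹ (inv_mem hy) k hk)
  simp only [inv_inv, Perm.mul_apply] at h
  exact Perm.inv_eq_iff_eq.mp h

variable [NeZero q]

/-- The vertex with entries `a` at `i`, `b` at `j`, and zero elsewhere. -/
def pairV (i j : Fin m) (a b : Fin q) : V m q :=
  fun k => if k = i then a else if k = j then b else 0

theorem pairV_left (i j : Fin m) (a b : Fin q) : pairV i j a b i = a := by simp [pairV]

theorem pairV_right {i j : Fin m} (h : i ≠ j) (a b : Fin q) : pairV i j a b j = b := by
  simp [pairV, h.symm]

theorem eq_or_eq_of_pairV_ne_zero {i j k : Fin m} {a b : Fin q} (h : pairV i j a b k ≠ 0) :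
    k = i ∨ k = j := by
  by_contra! hk
  exact h (by simp [pairV, hk.1, hk.2])

theorem hammingDist_pairV {i j : Fin m} (h : i ≠ j) {a b : Fin q} (ha : a ≠ 0) (hb : b ≠ 0) :
    hammingDist (pairV i j a b) (zeroV m q) = 2 := by
  unfold hammingDist
  rw [show (Finset.univ.filter fun k => pairV i j a b k ≠ zeroV m q k) = {i, j} from ?_,
    Finset.card_pair h]
  ext k
  rw [Finset.mem_filter_univ, Finset.mem_insert, Finset.mem_singleton]
  change pairV i j a b k ≠ 0 ↔ _
  constructor
  · exact fun hk => eq_or_eq_of_pairV_ne_zero hk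
  · rintro (rfl | rfl)
    · rwa [pairV_left]
    · rwa [pairV_right h]

theorem hAut_apply_eq_zero_iff {g : Fin m → Perm (Fin q)} {σ : Perm (Fin m)}
    (h : hAut m q g σ (zeroV m q) = zeroV m q) (α : V m q) (i : Fin m) :
    hAut m q g σ α i = 0 ↔ α (σ⁻¹ i) = 0 := by
  have hi : g i 0 = 0 := congrFun h i
  change g i (α (σ⁻¹ i)) = 0 ↔ _
  conv_lhs => rw [← hi]
  exact (g i).injective.eq_iff

/-- The stabiliser of the zero codeword is transitive on the vertices of weight two. -/
theorem IsNT.exists_map_of_weight_two {X : Subgroup (Perm (V m q))} {C : Set (V m q)}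
    (hNT : IsNT m q X C 2) (hδ : 5 ≤ minDist m q C) (h0 : zeroV m q ∈ C) {ν μ : V m q}
    (hν : hammingDist ν (zeroV m q) = 2) (hμ : hammingDist μ (zeroV m q) = 2) :
    ∃ g σ, hAut m q g σ ∈ X ∧ hAut m q g σ (zeroV m q) = zeroV m q ∧ hAut m q g σ ν = μ := by
  obtain ⟨hX, hC, hcell⟩ := hNT
  have hmem {α : V m q} (h : hammingDist α (zeroV m q) = 2) : α ∈ cell m q C 2 :=
    (distTo_eq_of_two_mul_le h0 (by omega)).trans h
  obtain ⟨x, hx, rfl⟩ := (hcell 2 one_le_two le_rfl).2.2 ν (hmem hν) μ (hmem hμ)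
  have hfix : x (zeroV m q) = zeroV m q := by
    by_contra hne
    have h1 := minDist_le (hC.2.1 x hx _ h0) h0 hne
    have h2 := hammingDist_triangle (x (zeroV m q)) (x ν) (zeroV m q)
    rw [hammingDist_apply_of_mem (hX hx), hammingDist_comm (zeroV m q) ν] at h2
    omega
  obtain ⟨g, σ, rfl⟩ := hX hx
  exact ⟨g, σ, hx, hfix, rfl⟩

/-- If a nontrivial subgroup of `X` fixes every codeword, then each codeword is either
zero or nowhere zero. -/
theorem apply_ne_zero_of_fixes {X K : Subgroup (Perm (V m q))} {C : Set (V m q)} (hq : 2 ≤ q)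
    (hNT : IsNT m q X C 2) (hδ : 5 ≤ minDist m q C) (hEF : EntryFaithful m q X)
    (h0 : zeroV m q ∈ C) (hKX : K ≤ X) (hK : K ≠ ⊥) (hfix : ∀ k ∈ K, ∀ β ∈ C, k β = β)
    {α : V m q} (hα : α ∈ C) (hne : α ≠ zeroV m q) (k : Fin m) : α k ≠ 0 := by
  obtain ⟨⟨n, hn⟩, hn1⟩ := (Subgroup.ne_bot_iff_exists_ne_one).mp hK
  replace hn1 : n ≠ 1 := fun h => hn1 (Subtype.ext h)
  obtain ⟨g, σ, rfl⟩ := hNT.1 (hKX hn)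
  have hσ : σ ≠ 1 := by
    rintro rfl
    exact hn1 (hEF _ (hKX hn) ⟨g, rfl⟩)
  obtain ⟨i, hi⟩ : ∃ i, σ i ≠ i := by
    by_contra! h
    exact hσ (Perm.ext h)
  have hone : (⟨1, hq⟩ : Fin q) ≠ 0 := by
    simp [Fin.ext_iff]
  have hβ (β : V m q) (hβ : β ∈ C) : β (σ i) = 0 ↔ β i = 0 := by
    have h := hAut_apply_eq_zero_iff (hfix _ hn _ h0) β (σ i)
    rwa [hfix _ hn _ hβ, Perm.inv_def, symm_apply_apply] at h
  intro hk
  refine hne (funext fun l => ?_)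
  by_cases hkl : k = l
  · rw [← hkl, hk]; rfl
  obtain ⟨h, τ, hx, hx0, hxν⟩ := hNT.exists_map_of_weight_two hδ h0
    (hammingDist_pairV hi.symm hone hone) (hammingDist_pairV hkl hone hone)
  obtain ⟨β, hβC, rfl⟩ : ∃ β ∈ C, hAut m q h τ β = α :=
    ⟨_, hNT.2.1.2.1 _ (inv_mem hx) _ hα, apply_symm_apply _ _⟩
  have hτ (j : Fin m) (hj : pairV k l (⟨1, hq⟩ : Fin q) ⟨1, hq⟩ j ≠ 0) :
      τ⁻¹ j = i ∨ τ⁻¹ j = σ i := by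
    rw [← hxν, Ne, hAut_apply_eq_zero_iff hx0] at hj
    exact eq_or_eq_of_pairV_ne_zero hj
  have hτk := hτ k (by rwa [pairV_left])
  have hτl := hτ l (by rwa [pairV_right hkl])
  change hAut m q h τ β l = 0
  rw [hAut_apply_eq_zero_iff hx0] at hk ⊢
  have := hβ β hβC
  rcases hτk with e | e <;> rcases hτl with e' | e' <;> rw [e] at hk <;> rw [e'] <;> tauto

/-- If nonzero codewords are nowhere zero, then distinct codewords differ everywhere. -/
theorem apply_ne_apply_of_ne {X : Subgroup (Perm (V m q))} {C : Set (V m q)}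
    (hX : X ≤ HammingAut m q) (hC : IsOrbit m q X C) (h0 : zeroV m q ∈ C)
    (h : ∀ α ∈ C, α ≠ zeroV m q → ∀ k, α k ≠ 0) {α β : V m q} (hα : α ∈ C) (hβ : β ∈ C)
    (hne : α ≠ β) (k : Fin m) : α k ≠ β k := by
  obtain ⟨y, hy, rfl⟩ := hC.2.2 _ h0 β hβ
  obtain ⟨γ, hγ, rfl⟩ : ∃ γ ∈ C, y γ = α :=
    ⟨_, hC.2.1 _ (inv_mem hy) _ hα, apply_symm_apply _ _⟩
  obtain ⟨g, σ, rfl⟩ := hX hy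
  exact fun e => h γ hγ (fun e' => hne (by rw [e'])) _ ((g k).injective e)

/-- If distinct codewords differ everywhere, the alphabet is binary. -/
theorem IsNT.alphabet_eq_two {X : Subgroup (Perm (V m q))} {C : Set (V m q)} (hm : 2 ≤ m)
    (hq : 2 ≤ q) (hNT : IsNT m q X C 2) (hδ : 5 ≤ minDist m q C) (h0 : zeroV m q ∈ C)
    (hdiff : ∀ α ∈ C, ∀ β ∈ C, α ≠ β → ∀ k, α k ≠ β k) {α : V m q} (hα : α ∈ C)
    (hne : α ≠ zeroV m q) : q = 2 := by
  by_contra hq2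
  have hα0 (k : Fin m) : α k ≠ 0 := hdiff α hα _ h0 hne k
  set i : Fin m := ⟨0, by omega⟩
  set j : Fin m := ⟨1, by omega⟩
  have hij : i ≠ j := by simp [i, j]
  obtain ⟨c, hc⟩ : ∃ c : Fin q, c ∉ ({0, α j} : Finset (Fin q)) := by
    by_contra! h
    have h1 := Finset.card_le_card (fun c _ => h c : Finset.univ ⊆ ({0, α j} : Finset (Fin q)))
    have h2 := Finset.card_le_two (a := (0 : Fin q)) (b := α j)
    rw [Finset.card_univ, Fintype.card_fin] at h1
    omega
  simp only [Finset.mem_insert, Finset.mem_singleton, not_or] at hc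
  obtain ⟨h, τ, hx, hx0, hxν⟩ := hNT.exists_map_of_weight_two hδ h0
    (hammingDist_pairV hij (hα0 i) (hα0 j)) (hammingDist_pairV hij (hα0 i) hc.1)
  have key (k : Fin m) (hk : pairV i j (α i) c k ≠ 0) :
      hAut m q h τ α k = pairV i j (α i) c k := by
    have hk' := hk
    rw [← hxν, Ne, hAut_apply_eq_zero_iff hx0] at hk'
    rw [← hxν]
    change h k (α (τ⁻¹ k)) = h k (pairV i j (α i) (α j) (τ⁻¹ k))
    rcases eq_or_eq_of_pairV_ne_zero hk' with e | e <;> rw [e]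
    · rw [pairV_left]
    · rw [pairV_right hij]
  have hi := key i (by rw [pairV_left]; exact hα0 i)
  have hj := key j (by rw [pairV_right hij]; exact hc.1)
  rw [pairV_left] at hi
  rw [pairV_right hij] at hj
  refine hdiff _ (hNT.2.1.2.1 _ hx _ hα) α hα (fun e => hc.2 ?_) i hi
  rw [← hj, e]

end NT

open NT Equiv in
/-- Lemma 3.2: if `C` is entry-faithful `(X,2)`-neighbour transitive
with `|C| ≥ 2`, `δ ≥ 5`, `0 ∈ C`, and `soc(X) = soc(X₀)`, then `δ = m`, `q = 2`,
and `C` is equivalent to the binary repetition code. -/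
theorem stmt_12 (m q : ℕ) [NeZero q] (hm : 2 ≤ m) (hq : 2 ≤ q)
    (X : Subgroup (Perm (V m q))) (C : Set (V m q))
    (hC : 2 ≤ C.ncard) (hδ : 5 ≤ minDist m q C)
    (hNT : IsNT m q X C 2) (hEF : EntryFaithful m q X)
    (h0 : zeroV m q ∈ C)
    (hsoc : socleIn X = socleIn (X ⊓ MulAction.stabilizer (Perm (V m q)) (zeroV m q))) :
    minDist m q C = m ∧ q = 2 ∧ CodeEquiv m q C (RepCode m q) := by
  obtain ⟨α, hα, hα0⟩ := Set.exists_ne_of_one_lt_ncard (by omega : 1 < C.ncard) (zeroV m q)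
  have hm5 : 5 ≤ m := by
    have h1 := minDist_le hα h0 hα0
    have h2 : hammingDist α (zeroV m q) ≤ Fintype.card (Fin m) := hammingDist_le_card_fintype
    rw [Fintype.card_fin] at h2
    omega
  have hXbot : X ≠ ⊥ := by
    rintro rfl
    have hone : (⟨1, hq⟩ : Fin q) ≠ 0 := by simp [Fin.ext_iff]
    obtain ⟨g, σ, hx, -, hxν⟩ := hNT.exists_map_of_weight_two hδ h0
      (hammingDist_pairV (i := ⟨0, by omega⟩) (j := ⟨1, by omega⟩) (by simp) hone hone)
      (hammingDist_pairV (i := ⟨0, by omega⟩) (j := ⟨2, by omega⟩) (by simp) hone hone)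
    rw [Subgroup.mem_bot.mp hx] at hxν
    simpa [pairV, Fin.ext_iff] using congrFun hxν ⟨1, by omega⟩
  obtain ⟨K, hK⟩ := exists_isMinNormalIn hXbot
  have hK0 : K ≤ X ⊓ MulAction.stabilizer (Perm (V m q)) (zeroV m q) :=
    (hK.le_socleIn.trans hsoc.le).trans (socleIn_le _)
  have hnz (β) (hβ : β ∈ C) (hne : β ≠ zeroV m q) : ∀ k, β k ≠ 0 :=
    apply_ne_zero_of_fixes hq hNT hδ hEF h0 hK.1 hK.2.1
      (fun k hk β hβ => hNT.2.1.apply_eq_of_normalised hK.2.2.1 h0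
        (fun k hk => (hK0 hk).2) hk hβ) hβ hne
  have hdiff : ∀ α ∈ C, ∀ β ∈ C, α ≠ β → ∀ k, α k ≠ β k :=
    fun α hα β hβ hne => apply_ne_apply_of_ne hNT.1 hNT.2.1 h0 hnz hα hβ hne
  have hdist (β γ) (hβ : β ∈ C) (hγ : γ ∈ C) (hne : β ≠ γ) : hammingDist β γ = m := by
    simp [hammingDist, hdiff β hβ γ hγ hne]
  have hq2 := hNT.alphabet_eq_two hm hq hδ h0 hdiff hα hα0
  refine ⟨?_, hq2, 1, one_mem _, ?_⟩
  · refine le_antisymm ((minDist_le hα h0 hα0).trans_eq (hdist _ _ hα h0 hα0))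
      (le_csInf ⟨_, α, hα, _, h0, hα0, rfl⟩ ?_)
    rintro d ⟨β, hβ, γ, hγ, hne, rfl⟩
    exact (hdist _ _ hβ hγ hne).ge
  · have hval (a b : Fin q) (ha : a ≠ 0) (hb : b ≠ 0) : a = b := by
      simp only [Ne, Fin.ext_iff, Fin.val_zero] at ha hb ⊢
      omega
    rw [Perm.coe_one, Set.image_id]
    ext β
    constructor
    · intro hβ
      by_cases h : β = zeroV m q
      · exact ⟨0, h⟩
      · exact ⟨β ⟨0, by omega⟩, funext fun k => hval _ _ (hnz β hβ h _) (hnz β hβ h _)⟩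
    · rintro ⟨a, rfl⟩
      by_cases ha : a = 0
      · rwa [ha]
      · rwa [show (fun _ => a) = α from funext fun k => hval _ _ ha (hnz α hα hα0 k)]
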